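/- Let H be a complex Hilbert space and A a bounded self-adjoint operator on H whose spectrum is contained in (0, ∞) (so A is positive definite and invertible; the paper proves this result for every invertible self-adjoint operator). Let I be a countable index set and g : I → H. Then {A^t g_i : i ∈ I, t ∈ [0, 1]} is a semi-continuous frame for H if and only if for every finite L > 0, {A^t g_i : i ∈ I, t ∈ [0, L]} is a semi-continuous frame for H. -/

import Mathlib

open scoped InnerProductSpace

namespace SemiFrame
open MeasureTheory Set
open scoped ENNReal NNReal

variable {H : Type*} [NormedAddCommGroup H] [InnerProductSpace ℂ H] {I : Type*}

/-- The extended-valued frame functional on `(0, L]`. -/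
noncomputable def Phi (E : ℝ → H →L[ℂ] H) (g : I → H) (L : ℝ) (f : H) : ℝ≥0∞ :=
  ∑' i, ∫⁻ t in Ioc (0 : ℝ) L, ‖⟪f, E t (g i)⟫_ℂ‖ₑ ^ 2

lemma Phi_mono (E : ℝ → H →L[ℂ] H) (g : I → H) {L L' : ℝ} (h : L ≤ L') (f : H) :
    Phi E g L f ≤ Phi E g L' f :=
  ENNReal.tsum_le_tsum fun _ => lintegral_mono_set (Ioc_subset_Ioc_right h)

lemma lintegral_shift (F : ℝ → ℝ≥0∞) (a b : ℝ) :
    ∫⁻ t in Ioc (0 : ℝ) b, F (t + a) = ∫⁻ t in Ioc a (a + b), F t := by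
  rw [← lintegral_indicator measurableSet_Ioc, ← lintegral_indicator measurableSet_Ioc,
    ← lintegral_add_right_eq_self (fun t => (Ioc a (a + b)).indicator F t) a]
  congr 1
  ext t
  simp only [indicator, mem_Ioc]
  congr 1
  simp only [eq_iff_iff]
  constructor <;> rintro ⟨h1, h2⟩ <;> constructor <;> linarith

lemma Phi_shift_eq (E : ℝ → H →L[ℂ] H) (g : I → H)
    (hE : ∀ a t f x, ⟪f, E (t + a) x⟫_ℂ = ⟪E a f, E t x⟫_ℂ) (a b : ℝ) (f : H) :
    Phi E g b (E a f) = ∑' i, ∫⁻ t in Ioc a (a + b), ‖⟪f, E t (g i)⟫_ℂ‖ₑ ^ 2 := by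
  unfold Phi
  congr 1
  ext i
  rw [← lintegral_shift]
  simp only [hE]

lemma Phi_shift_le (E : ℝ → H →L[ℂ] H) (g : I → H)
    (hE : ∀ a t f x, ⟪f, E (t + a) x⟫_ℂ = ⟪E a f, E t x⟫_ℂ) {a : ℝ} (ha : 0 ≤ a) (b : ℝ) (f : H) :
    Phi E g b (E a f) ≤ Phi E g (a + b) f := by
  rw [Phi_shift_eq E g hE]
  exact ENNReal.tsum_le_tsum fun _ => lintegral_mono_set (Ioc_subset_Ioc_left ha)

lemma Phi_add_le (E : ℝ → H →L[ℂ] H) (g : I → H)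
    (hE : ∀ a t f x, ⟪f, E (t + a) x⟫_ℂ = ⟪E a f, E t x⟫_ℂ) (a b : ℝ) (f : H) :
    Phi E g (a + b) f ≤ Phi E g a f + Phi E g b (E a f) := by
  rw [Phi_shift_eq E g hE, Phi, Phi, ← ENNReal.tsum_add]
  refine ENNReal.tsum_le_tsum fun i => ?_
  refine le_trans (lintegral_mono_set (t := Ioc 0 a ∪ Ioc a (a + b)) ?_) (lintegral_union_le _ _ _)
  exact Ioc_subset_Ioc_union_Ioc

lemma Phi_mul_le (E : ℝ → H →L[ℂ] H) (g : I → H)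
    (hE : ∀ a t f x, ⟪f, E (t + a) x⟫_ℂ = ⟪E a f, E t x⟫_ℂ) (d : ℝ) (N : ℕ) (f : H) :
    Phi E g (N * d) f ≤ ∑ k ∈ Finset.range N, Phi E g d (E (k * d) f) := by
  induction N with
  | zero => simp [Phi]
  | succ n ih =>
    rw [Finset.sum_range_succ]
    push_cast
    rw [add_mul, one_mul]
    exact (Phi_add_le E g hE _ _ f).trans (by gcongr)

lemma enorm_add_sq_le {X : Type*} [SeminormedAddCommGroup X] (x y : X) :
    ‖x + y‖ₑ ^ 2 ≤ 2 * ‖x‖ₑ ^ 2 + 2 * ‖y‖ₑ ^ 2 := by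
  have h : ‖x + y‖ ^ 2 ≤ 2 * ‖x‖ ^ 2 + 2 * ‖y‖ ^ 2 := by
    have := norm_add_le x y
    nlinarith [sq_nonneg (‖x‖ - ‖y‖), norm_nonneg (x + y), norm_nonneg x, norm_nonneg y]
  have h2 : ‖x + y‖₊ ^ 2 ≤ 2 * ‖x‖₊ ^ 2 + 2 * ‖y‖₊ ^ 2 := by exact_mod_cast h
  simp only [enorm_eq_nnnorm]
  exact_mod_cast h2

lemma Phi_add_vec (E : ℝ → H →L[ℂ] H) (hc : Continuous E) (g : I → H) (L : ℝ) (x y : H) :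
    Phi E g L (x + y) ≤ 2 * Phi E g L x + 2 * Phi E g L y := by
  unfold Phi
  rw [← ENNReal.tsum_mul_left, ← ENNReal.tsum_mul_left, ← ENNReal.tsum_add]
  refine ENNReal.tsum_le_tsum fun i => ?_
  have hm : ∀ x : H, Measurable fun t => ‖⟪x, E t (g i)⟫_ℂ‖ₑ ^ 2 := fun x =>
    Continuous.measurable (by fun_prop)
  rw [← lintegral_const_mul _ (hm x), ← lintegral_const_mul _ (hm y),
    ← lintegral_add_left ((hm x).const_mul 2)]
  refine lintegral_mono fun t => ?_
  simp only [inner_add_left]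
  exact enorm_add_sq_le _ _

lemma Phi_smul (E : ℝ → H →L[ℂ] H) (hc : Continuous E) (g : I → H) (L : ℝ) (c : ℂ) (x : H) :
    Phi E g L (c • x) = ‖c‖ₑ ^ 2 * Phi E g L x := by
  unfold Phi
  rw [← ENNReal.tsum_mul_left]
  congr 1
  ext i
  have hm : ∀ x : H, Measurable fun t => ‖⟪x, E t (g i)⟫_ℂ‖ₑ ^ 2 := fun x =>
    Continuous.measurable (by fun_prop)
  rw [← lintegral_const_mul _ (hm x)]
  congr 1
  ext t
  rw [inner_smul_left, enorm_mul, mul_pow]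
  simp

/-- The operators which can be controlled by the functional `Phi L`. -/
def W (E : ℝ → H →L[ℂ] H) (hc : Continuous E) (g : I → H) (d L : ℝ) : Submodule ℂ (H →L[ℂ] H) where
  carrier := {X | ∀ ε : ℝ≥0, 0 < ε → ∃ K : ℝ≥0, ∀ f : H,
    Phi E g d (X f) ≤ K * Phi E g L f + ε * ‖f‖ₑ ^ 2}
  zero_mem' := by
    intro ε _
    refine ⟨0, fun f => ?_⟩
    simp [Phi]
  add_mem' := by
    intro X Y hX hY ε hε
    obtain ⟨K, hK⟩ := hX (ε / 4) (by positivity)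
    obtain ⟨K', hK'⟩ := hY (ε / 4) (by positivity)
    refine ⟨2 * K + 2 * K', fun f => ?_⟩
    have h4 : (ε : ℝ≥0∞) = 2 * ((ε / 4 : ℝ≥0) : ℝ≥0∞) + 2 * ((ε / 4 : ℝ≥0) : ℝ≥0∞) := by
      norm_cast
      rw [← NNReal.coe_inj]; push_cast; ring
    calc Phi E g d ((X + Y) f) ≤ 2 * Phi E g d (X f) + 2 * Phi E g d (Y f) :=
          Phi_add_vec E hc g d _ _
      _ ≤ 2 * (K * Phi E g L f + (ε / 4 : ℝ≥0) * ‖f‖ₑ ^ 2)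
          + 2 * (K' * Phi E g L f + (ε / 4 : ℝ≥0) * ‖f‖ₑ ^ 2) := by
          gcongr
          · exact hK f
          · exact hK' f
      _ = _ := by
          rw [h4]; push_cast; ring
  smul_mem' := by
    intro c X hX ε hε
    obtain ⟨K, hK⟩ := hX (ε / (‖c‖₊ ^ 2 + 1)) (by positivity)
    refine ⟨‖c‖₊ ^ 2 * K, fun f => ?_⟩
    have h4 : ‖c‖ₑ ^ 2 * ((ε / (‖c‖₊ ^ 2 + 1) : ℝ≥0) : ℝ≥0∞) ≤ ε := by
      rw [enorm_eq_nnnorm]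
      norm_cast
      rw [← mul_div_assoc, div_le_iff₀ (by positivity), mul_comm]
      gcongr
      simp
    calc Phi E g d ((c • X) f) = ‖c‖ₑ ^ 2 * Phi E g d (X f) := Phi_smul E hc g d _ _
      _ ≤ ‖c‖ₑ ^ 2 * (K * Phi E g L f + (ε / (‖c‖₊ ^ 2 + 1) : ℝ≥0) * ‖f‖ₑ ^ 2) := by
          gcongr
          exact hK f
      _ = ‖c‖ₑ ^ 2 * K * Phi E g L f
            + ‖c‖ₑ ^ 2 * ((ε / (‖c‖₊ ^ 2 + 1) : ℝ≥0) : ℝ≥0∞) * ‖f‖ₑ ^ 2 := by ring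
      _ ≤ _ := by
          push_cast
          rw [enorm_eq_nnnorm] at *
          gcongr

lemma W_closed (E : ℝ → H →L[ℂ] H) (hc : Continuous E) (g : I → H) (d L : ℝ) (C : ℝ≥0)
    (hC : ∀ f, Phi E g d f ≤ C * ‖f‖ₑ ^ 2) :
    IsClosed (W E hc g d L : Set (H →L[ℂ] H)) := by
  refine isClosed_of_closure_subset fun X hX => ?_
  intro ε hε
  rw [Metric.mem_closure_iff] at hX
  obtain ⟨η, hη, hηε⟩ : ∃ η : ℝ≥0, 0 < η ∧ 2 * (C * η ^ 2) ≤ ε / 2 := by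
    refine ⟨min 1 (ε / (4 * (C + 1))), by positivity, ?_⟩
    set η := min 1 (ε / (4 * (C + 1)))
    have h1 : η ≤ 1 := min_le_left _ _
    have h2 : η ≤ ε / (4 * (C + 1)) := min_le_right _ _
    rw [le_div_iff₀ (by positivity)] at h2
    rw [← NNReal.coe_le_coe] at *
    push_cast at *
    have := C.coe_nonneg
    have := η.coe_nonneg
    nlinarith [mul_nonneg C.coe_nonneg (mul_nonneg η.coe_nonneg (sub_nonneg.2 h1))]
  obtain ⟨Y, hY, hXY⟩ := hX η hη
  obtain ⟨K, hK⟩ := hY (ε / 4) (by positivity)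
  refine ⟨2 * K, fun f => ?_⟩
  have hn : ‖(X - Y) f‖ₑ ≤ η * ‖f‖ₑ := by
    refine ((X - Y).le_opENorm f).trans ?_
    gcongr
    rw [dist_eq_norm] at hXY
    rw [enorm_eq_nnnorm]
    exact_mod_cast hXY.le
  have h4 : 2 * ((C : ℝ≥0∞) * (η : ℝ≥0∞) ^ 2) + 2 * ((ε / 4 : ℝ≥0) : ℝ≥0∞) ≤ ε := by
    norm_cast
    rw [← NNReal.coe_le_coe] at *
    push_cast at *
    linarith
  calc Phi E g d (X f) = Phi E g d ((X - Y) f + Y f) := by simp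
    _ ≤ 2 * Phi E g d ((X - Y) f) + 2 * Phi E g d (Y f) := Phi_add_vec E hc g d _ _
    _ ≤ 2 * (C * (η * ‖f‖ₑ) ^ 2) + 2 * (K * Phi E g L f + (ε / 4 : ℝ≥0) * ‖f‖ₑ ^ 2) := by
        gcongr
        · exact (hC _).trans (by gcongr)
        · exact hK f
    _ = 2 * K * Phi E g L f +
        (2 * ((C : ℝ≥0∞) * (η : ℝ≥0∞) ^ 2) + 2 * ((ε / 4 : ℝ≥0) : ℝ≥0∞)) * ‖f‖ₑ ^ 2 := by ring
    _ ≤ _ := by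
        rw [ENNReal.coe_mul, ENNReal.coe_ofNat]
        exact add_le_add le_rfl (mul_le_mul_left h4 _)

/-- Identity theorem: the closed subspace contains all powers as soon as it contains those with
exponents in a short interval. -/
lemma exp_mem {R : Type*} [NormedRing R] [NormedAlgebra ℂ R] [CompleteSpace R]
    (B : R) (V : Submodule ℂ R) (hV : IsClosed (V : Set R)) (d : ℝ) (hd : 0 < d)
    (h : ∀ s ∈ Icc (0 : ℝ) d, NormedSpace.exp ((s : ℂ) • B) ∈ V) (z : ℂ) :
    NormedSpace.exp (z • B) ∈ V := by
  have : IsClosed (V : Set R) := hV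
  by_contra hz
  have hz' : V.mkQ (NormedSpace.exp (z • B)) ≠ 0 := by simpa using hz
  obtain ⟨l, hl⟩ := SeparatingDual.exists_ne_zero (R := ℂ) hz'
  let m : R →L[ℂ] (R ⧸ V) := ⟨V.mkQ, by exact continuous_quot_mk⟩
  have hdiff : Differentiable ℂ (fun z : ℂ => l (m (NormedSpace.exp (z • B)))) := by
    intro w
    have := (hasDerivAt_exp_smul_const (𝕂 := ℂ) B w).differentiableAt
    fun_prop
  have han : AnalyticOnNhd ℂ (fun z : ℂ => l (m (NormedSpace.exp (z • B)))) univ :=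
    hdiff.differentiableOn.analyticOnNhd isOpen_univ
  have hfr : ∃ᶠ w in nhdsWithin (0 : ℂ) {0}ᶜ,
      l (m (NormedSpace.exp (w • B))) = (fun _ : ℂ => (0 : ℂ)) w := by
    have ht : Filter.Tendsto (fun s : ℝ => (s : ℂ)) (nhdsWithin 0 (Ioi 0))
        (nhdsWithin (0 : ℂ) {0}ᶜ) := by
      refine tendsto_nhdsWithin_iff.2 ⟨?_, ?_⟩
      · exact (Complex.continuous_ofReal.tendsto' 0 0 (by simp)).mono_left nhdsWithin_le_nhds
      · filter_upwards [self_mem_nhdsWithin] with s hs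
        simpa using (ne_of_gt hs)
    refine ht.frequently (Filter.Eventually.frequently ?_)
    filter_upwards [Ioc_mem_nhdsGT hd] with s hs
    have : m (NormedSpace.exp ((s : ℂ) • B)) = 0 := by
      exact (Submodule.Quotient.mk_eq_zero V).2 (h s ⟨hs.1.le, hs.2⟩)
    rw [this, map_zero]
  have := han.eqOn_of_preconnected_of_frequently_eq (analyticOnNhd_const (v := (0:ℂ)))
    isPreconnected_univ (mem_univ 0) hfr (mem_univ z)
  exact hl this


lemma term_eq (E : ℝ → H →L[ℂ] H) (hc : Continuous E) (x : H) {L : ℝ} (hL : 0 ≤ L) (f : H) :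
    ENNReal.ofReal (∫ t in (0 : ℝ)..L, ‖⟪f, E t x⟫_ℂ‖ ^ 2) =
      ∫⁻ t in Ioc (0 : ℝ) L, ‖⟪f, E t x⟫_ℂ‖ₑ ^ 2 := by
  have hcont : Continuous fun t => ‖⟪f, E t x⟫_ℂ‖ ^ 2 := by fun_prop
  rw [intervalIntegral.integral_of_le hL, ofReal_integral_eq_lintegral_ofReal
    (hcont.integrableOn_Ioc) (Filter.Eventually.of_forall fun t => by positivity)]
  congr 1
  ext t
  rw [ENNReal.ofReal_pow (norm_nonneg _), ofReal_norm]

lemma term_nonneg (E : ℝ → H →L[ℂ] H) (x : H) {L : ℝ} (hL : 0 ≤ L) (f : H) :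
    0 ≤ ∫ t in (0 : ℝ)..L, ‖⟪f, E t x⟫_ℂ‖ ^ 2 :=
  intervalIntegral.integral_nonneg hL fun _ _ => by positivity

lemma ofReal_mul_norm_sq {c : ℝ} (hc : 0 ≤ c) (f : H) :
    ENNReal.ofReal (c * ‖f‖ ^ 2) = (c.toNNReal : ℝ≥0∞) * ‖f‖ₑ ^ 2 := by
  rw [ENNReal.ofReal_mul hc, ENNReal.ofReal_pow (norm_nonneg _), ofReal_norm]
  rfl

lemma Phi_of_real (E : ℝ → H →L[ℂ] H) (hE : Continuous E) (g : I → H) {L : ℝ} (hL : 0 ≤ L)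
    {c C : ℝ} (hc : 0 < c) (hcC : c ≤ C) (f : H)
    (h1 : c * ‖f‖ ^ 2 ≤ ∑' i, ∫ t in (0 : ℝ)..L, ‖⟪f, E t (g i)⟫_ℂ‖ ^ 2)
    (h2 : ∑' i, ∫ t in (0 : ℝ)..L, ‖⟪f, E t (g i)⟫_ℂ‖ ^ 2 ≤ C * ‖f‖ ^ 2) :
    (c.toNNReal : ℝ≥0∞) * ‖f‖ₑ ^ 2 ≤ Phi E g L f ∧
      Phi E g L f ≤ (C.toNNReal : ℝ≥0∞) * ‖f‖ₑ ^ 2 := by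
  by_cases hf : f = 0
  · subst hf
    simp [Phi]
  have hpos : 0 < c * ‖f‖ ^ 2 := by positivity
  have hs : Summable fun i => ∫ t in (0 : ℝ)..L, ‖⟪f, E t (g i)⟫_ℂ‖ ^ 2 := by
    by_contra hs
    rw [tsum_eq_zero_of_not_summable hs] at h1
    linarith
  have key : Phi E g L f =
      ENNReal.ofReal (∑' i, ∫ t in (0 : ℝ)..L, ‖⟪f, E t (g i)⟫_ℂ‖ ^ 2) := by
    rw [ENNReal.ofReal_tsum_of_nonneg (fun i => term_nonneg E (g i) hL f) hs]
    simp only [Phi, term_eq E hE _ hL]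
  rw [← ofReal_mul_norm_sq hc.le, ← ofReal_mul_norm_sq (hc.le.trans hcC), key]
  exact ⟨ENNReal.ofReal_le_ofReal h1, ENNReal.ofReal_le_ofReal h2⟩

lemma real_of_Phi (E : ℝ → H →L[ℂ] H) (hE : Continuous E) (g : I → H) {L : ℝ} (hL : 0 ≤ L)
    {c C : ℝ≥0} (f : H)
    (h1 : (c : ℝ≥0∞) * ‖f‖ₑ ^ 2 ≤ Phi E g L f) (h2 : Phi E g L f ≤ (C : ℝ≥0∞) * ‖f‖ₑ ^ 2) :
    (c : ℝ) * ‖f‖ ^ 2 ≤ ∑' i, ∫ t in (0 : ℝ)..L, ‖⟪f, E t (g i)⟫_ℂ‖ ^ 2 ∧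
    ∑' i, ∫ t in (0 : ℝ)..L, ‖⟪f, E t (g i)⟫_ℂ‖ ^ 2 ≤ C * ‖f‖ ^ 2 := by
  have hfin : Phi E g L f ≠ ∞ := by
    refine ne_top_of_le_ne_top ?_ h2
    rw [enorm_eq_nnnorm]
    exact_mod_cast ENNReal.coe_ne_top
  have key : ∑' i, ∫ t in (0 : ℝ)..L, ‖⟪f, E t (g i)⟫_ℂ‖ ^ 2 = (Phi E g L f).toReal := by
    unfold Phi at hfin ⊢
    rw [ENNReal.tsum_toReal_eq (fun i => ENNReal.ne_top_of_tsum_ne_top hfin i)]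
    congr 1
    ext i
    rw [← term_eq E hE _ hL, ENNReal.toReal_ofReal (term_nonneg E (g i) hL f)]
  have hr : ∀ c : ℝ≥0, ((c : ℝ≥0∞) * ‖f‖ₑ ^ 2).toReal = c * ‖f‖ ^ 2 := by
    intro c
    simp
  rw [key, ← hr, ← hr]
  refine ⟨ENNReal.toReal_mono hfin h1, ENNReal.toReal_mono ?_ h2⟩
  rw [enorm_eq_nnnorm]
  exact_mod_cast ENNReal.coe_ne_top

/-- Upper bound for all lengths. -/
lemma Phi_upper (E : ℝ → H →L[ℂ] H) (g : I → H)
    (hE : ∀ a t f x, ⟪f, E (t + a) x⟫_ℂ = ⟪E a f, E t x⟫_ℂ) (C : ℝ≥0)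
    (hC : ∀ f, Phi E g 1 f ≤ C * ‖f‖ₑ ^ 2) (L : ℝ) :
    ∃ C' : ℝ≥0, ∀ f, Phi E g L f ≤ C' * ‖f‖ₑ ^ 2 := by
  obtain ⟨N, hN⟩ := exists_nat_ge L
  refine ⟨∑ k ∈ Finset.range N, C * ‖E (k * 1)‖₊ ^ 2, fun f => ?_⟩
  calc Phi E g L f ≤ Phi E g (N * 1) f := Phi_mono E g (by simpa using hN) f
    _ ≤ ∑ k ∈ Finset.range N, Phi E g 1 (E (k * 1) f) := Phi_mul_le E g hE 1 N f
    _ ≤ ∑ k ∈ Finset.range N, (C * ‖E (k * 1)‖₊ ^ 2) * ‖f‖ₑ ^ 2 := by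
        refine Finset.sum_le_sum fun k _ => (hC _).trans ?_
        rw [mul_assoc, ← mul_pow]
        gcongr
        exact (E (k * 1)).le_opENorm f
    _ = _ := by
        rw [← Finset.sum_mul]
        push_cast
        rfl

/-- Lower bound for all lengths. -/
lemma Phi_lower [CompleteSpace H] (B : H →L[ℂ] H) (E : ℝ → H →L[ℂ] H)
    (hB : ∀ t : ℝ, E t = NormedSpace.exp ((t : ℂ) • B)) (hc : Continuous E) (g : I → H)
    (hE : ∀ a t f x, ⟪f, E (t + a) x⟫_ℂ = ⟪E a f, E t x⟫_ℂ) (c C : ℝ≥0) (hc0 : 0 < c)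
    (hl : ∀ f, c * ‖f‖ₑ ^ 2 ≤ Phi E g 1 f)
    (hC : ∀ f, Phi E g 1 f ≤ C * ‖f‖ₑ ^ 2) (L : ℝ) (hL : 0 < L) :
    ∃ c' : ℝ≥0, 0 < c' ∧ ∀ f, c' * ‖f‖ₑ ^ 2 ≤ Phi E g L f := by
  set d := L / 2 with hd
  have hd0 : 0 < d := by positivity
  obtain ⟨C', hC'⟩ := Phi_upper E g hE C hC d
  have hmem : ∀ t : ℝ, E t ∈ W E hc g d L := by
    intro t
    rw [hB]
    refine exp_mem B _ (W_closed E hc g d L C' hC') d hd0 ?_ _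
    intro s hs ε hε
    refine ⟨1, fun f => ?_⟩
    rw [← hB]
    refine (Phi_shift_le E g hE hs.1 d f).trans ((Phi_mono E g (?_ : s + d ≤ L) f).trans ?_)
    · linarith [hs.2]
    · simp
  obtain ⟨N, hN⟩ := exists_nat_ge (1 / d)
  rw [div_le_iff₀ hd0] at hN
  choose K hK using fun k : ℕ => hmem (k * d) (c / (2 * (N + 1))) (by positivity)
  set S : ℝ≥0 := ∑ k ∈ Finset.range N, K k with hS
  have hmain : ∀ f, (c : ℝ≥0∞) * ‖f‖ₑ ^ 2 ≤ S * Phi E g L f + (c / 2 : ℝ≥0) * ‖f‖ₑ ^ 2 := by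
    intro f
    calc (c : ℝ≥0∞) * ‖f‖ₑ ^ 2 ≤ Phi E g 1 f := hl f
      _ ≤ Phi E g (N * d) f := Phi_mono E g hN f
      _ ≤ ∑ k ∈ Finset.range N, Phi E g d (E (k * d) f) := Phi_mul_le E g hE d N f
      _ ≤ ∑ k ∈ Finset.range N, (K k * Phi E g L f + (c / (2 * (N + 1)) : ℝ≥0) * ‖f‖ₑ ^ 2) :=
          Finset.sum_le_sum fun k _ => hK k f
      _ = S * Phi E g L f + ((N * (c / (2 * (N + 1))) : ℝ≥0) : ℝ≥0∞) * ‖f‖ₑ ^ 2 := by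
          rw [Finset.sum_add_distrib, ← Finset.sum_mul, hS, Finset.sum_const, Finset.card_range,
            nsmul_eq_mul, ENNReal.coe_mul, ENNReal.coe_natCast, mul_assoc, ENNReal.ofNNReal_finsetSum]
      _ ≤ _ := by
          have : (N * (c / (2 * (N + 1))) : ℝ≥0) ≤ c / 2 := by
            rw [← mul_div_assoc, div_le_div_iff₀ (by positivity) (by positivity)]
            rw [← NNReal.coe_le_coe]
            push_cast
            nlinarith [c.coe_nonneg]
          gcongr
  have hmain2 : ∀ f, ((c / 2 : ℝ≥0) : ℝ≥0∞) * ‖f‖ₑ ^ 2 ≤ (S + 1 : ℝ≥0) * Phi E g L f := by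
    intro f
    have h := hmain f
    have hcc : (c : ℝ≥0∞) = (c / 2 : ℝ≥0) + (c / 2 : ℝ≥0) := by
      rw [← ENNReal.coe_add, add_halves]
    rw [hcc, add_mul] at h
    have hfin : ((c / 2 : ℝ≥0) : ℝ≥0∞) * ‖f‖ₑ ^ 2 ≠ ∞ := by
      rw [enorm_eq_nnnorm]
      exact_mod_cast ENNReal.coe_ne_top
    refine (ENNReal.le_of_add_le_add_right hfin h).trans ?_
    gcongr
    simp
  refine ⟨c / 2 / (S + 1), by positivity, fun f => ?_⟩
  rw [ENNReal.coe_div (by positivity), div_eq_mul_inv, mul_right_comm, ← div_eq_mul_inv]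
  refine ENNReal.div_le_of_le_mul ?_
  rw [mul_comm (Phi E g L f)]
  exact hmain2 f

/-- The operator power is an exponential. -/
lemma cfc_cpow_eq_exp [CompleteSpace H] (A : H →L[ℂ] H) (hA : IsSelfAdjoint A)
    (hspec : spectrum ℂ A ⊆ (fun x : ℝ => (x : ℂ)) '' Set.Ioi (0 : ℝ)) :
    ∃ B : H →L[ℂ] H, IsSelfAdjoint B ∧ ∀ t : ℝ,
      cfc (fun z : ℂ => z ^ (t : ℂ)) A = NormedSpace.exp ((t : ℂ) • B) := by
  have hn : IsStarNormal A := hA.isStarNormal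
  have hlog : ContinuousOn Complex.log (spectrum ℂ A) := by
    intro z hz
    obtain ⟨x, hx, rfl⟩ := hspec hz
    refine (continuousAt_clog ?_).continuousWithinAt
    exact Complex.ofReal_mem_slitPlane.2 hx
  refine ⟨cfc Complex.log A, ?_, fun t => ?_⟩
  · rw [isSelfAdjoint_iff, ← cfc_star]
    refine cfc_congr fun z hz => ?_
    obtain ⟨x, hx, rfl⟩ := hspec hz
    have hx' : (0 : ℝ) < x := hx
    simp only [← Complex.ofReal_log hx'.le]
    simp
  · have hm : ContinuousOn (fun z : ℂ => (t : ℂ) * Complex.log z) (spectrum ℂ A) :=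
      continuousOn_const.mul hlog
    rw [← cfc_smul (t : ℂ) Complex.log A hlog,
      ← CFC.complex_exp_eq_normedSpace_exp (cfc_predicate _ A),
      ← cfc_comp' Complex.exp (fun z : ℂ => (t : ℂ) • Complex.log z) A
        Complex.continuous_exp.continuousOn hm hn]
    refine cfc_congr fun z hz => ?_
    obtain ⟨x, hx, rfl⟩ := hspec hz
    have hx' : (0 : ℝ) < x := hx
    have : (x : ℂ) ≠ 0 := by exact_mod_cast hx'.ne'
    simp only [Complex.cpow_def_of_ne_zero this, smul_eq_mul, mul_comm]

end SemiFrame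

/-- For a bounded self-adjoint operator `A` with spectrum contained in `(0, ∞)`, the system
`{A^t gᵢ : i ∈ I, t ∈ [0,1]}` is a semi-continuous frame for `H` if and only if
`{A^t gᵢ : i ∈ I, t ∈ [0,L]}` is a semi-continuous frame for every finite `L > 0`. -/
theorem semicontinuous_frame_unit_interval_iff_all_lengths
    {H : Type*} [NormedAddCommGroup H] [InnerProductSpace ℂ H] [CompleteSpace H]
    (A : H →L[ℂ] H) (hA : IsSelfAdjoint A)
    (hspec : spectrum ℂ A ⊆ (fun x : ℝ => (x : ℂ)) '' Set.Ioi (0 : ℝ))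
    {I : Type*} [Countable I] (g : I → H) :
    (∃ c C : ℝ, 0 < c ∧ c ≤ C ∧ ∀ f : H,
      c * ‖f‖ ^ 2 ≤
          ∑' i : I, ∫ t in (0 : ℝ)..(1 : ℝ),
            ‖⟪f, (cfc (fun z : ℂ => z ^ (t : ℂ)) A) (g i)⟫_ℂ‖ ^ 2 ∧
      ∑' i : I, ∫ t in (0 : ℝ)..(1 : ℝ),
          ‖⟪f, (cfc (fun z : ℂ => z ^ (t : ℂ)) A) (g i)⟫_ℂ‖ ^ 2 ≤ C * ‖f‖ ^ 2)
      ↔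
    (∀ L : ℝ, 0 < L →
      ∃ c C : ℝ, 0 < c ∧ c ≤ C ∧ ∀ f : H,
        c * ‖f‖ ^ 2 ≤
            ∑' i : I, ∫ t in (0 : ℝ)..L,
              ‖⟪f, (cfc (fun z : ℂ => z ^ (t : ℂ)) A) (g i)⟫_ℂ‖ ^ 2 ∧
        ∑' i : I, ∫ t in (0 : ℝ)..L,
            ‖⟪f, (cfc (fun z : ℂ => z ^ (t : ℂ)) A) (g i)⟫_ℂ‖ ^ 2 ≤ C * ‖f‖ ^ 2) := by
  constructor
  swap
  · intro h
    exact h 1 one_pos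
  obtain ⟨B, hBsa, hB⟩ := SemiFrame.cfc_cpow_eq_exp A hA hspec
  letI : NormedAlgebra ℚ (H →L[ℂ] H) := NormedAlgebra.restrictScalars ℚ ℂ (H →L[ℂ] H)
  let E : ℝ → H →L[ℂ] H := fun t => cfc (fun z : ℂ => z ^ (t : ℂ)) A
  have hBE : ∀ t : ℝ, E t = NormedSpace.exp ((t : ℂ) • B) := hB
  have hcont : Continuous E := by
    have : E = fun t : ℝ => NormedSpace.exp ((t : ℂ) • B) := funext hBE
    rw [this]
    exact NormedSpace.exp_continuous.comp (by fun_prop)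
  have hsa : ∀ t, IsSelfAdjoint (E t) := by
    intro t
    rw [hBE]
    refine IsSelfAdjoint.exp (IsSelfAdjoint.smul ?_ hBsa)
    simp [isSelfAdjoint_iff]
  have hE : ∀ a t f x, ⟪f, E (t + a) x⟫_ℂ = ⟪E a f, E t x⟫_ℂ := by
    intro a t f x
    have hmul : E (t + a) = E a * E t := by
      rw [hBE, hBE, hBE, ← NormedSpace.exp_add_of_commute]
      · rw [← add_smul]
        push_cast
        rw [add_comm]
      · exact ((Commute.refl B).smul_left _).smul_right _
    rw [hmul]
    have h1 := ContinuousLinearMap.adjoint_inner_left (E a) (E t x) f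
    rw [ContinuousLinearMap.isSelfAdjoint_iff'.1 (hsa a)] at h1
    exact h1.symm
  rintro ⟨c, C, hc, hcC, h⟩ L hL
  have hP := fun f => SemiFrame.Phi_of_real E hcont g zero_le_one hc hcC f (h f).1 (h f).2
  obtain ⟨C', hC'⟩ := SemiFrame.Phi_upper E g hE C.toNNReal (fun f => (hP f).2) L
  obtain ⟨c', hc'0, hc'⟩ := SemiFrame.Phi_lower B E hBE hcont g hE c.toNNReal C.toNNReal
    (Real.toNNReal_pos.2 hc) (fun f => (hP f).1) (fun f => (hP f).2) L hL
  refine ⟨c', max c' C', hc'0, le_max_left _ _, fun f => ?_⟩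
  obtain ⟨h1, h2⟩ := SemiFrame.real_of_Phi E hcont g hL.le f (hc' f) (hC' f)
  refine ⟨h1, h2.trans ?_⟩
  gcongr
  exact le_max_right _ _
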